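/- Let Σ be a finite alphabet and φ : Σ* → Σ* a nonerasing morphism. Then there exists an integer n ≥ 1 such that for every integer k ≥ 1 and every letter b ∈ Σ of order > k (a finite order greater than k, or order ∞): the leftmost letter of order > k occurring in φ^(nm)(b) is the same letter of Σ for all m ≥ 1, and the rightmost letter of order > k occurring in φ^(nm)(b) is the same letter of Σ for all m ≥ 1. (Note that if b has order > k then each φ^(nm)(b) contains at least one letter of order > k.) -/

import Mathlib

open Asymptotics Filter

/-- Apply a morphism (given by its values on letters) to a finite word. -/
def substWord {A : Type*} (φ : A → List A) : List A → List A
  | [] => []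
  | a :: w => φ a ++ substWord φ w

/-- The `n`-th iterate of a morphism applied to a word. -/
def iterWord {A : Type*} (φ : A → List A) (n : ℕ) (w : List A) : List A :=
  (substWord φ)^[n] w

/-- The letter `b` has finite order `k`: `k ≥ 1` and `|φ^n(b)| = Θ(n^(k−1))`. -/
def HasOrder {A : Type*} (φ : A → List A) (b : A) (k : ℕ) : Prop :=
  1 ≤ k ∧
    (fun n => ((iterWord φ n [b]).length : ℝ)) =Θ[atTop] (fun n => (n : ℝ) ^ (k - 1))

/-- The letter `b` has order `∞`: `|φ^n(b)| = Ω(q^n)` for some real `q > 1`. -/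
def HasOrderInf {A : Type*} (φ : A → List A) (b : A) : Prop :=
  ∃ q : ℝ, 1 < q ∧
    (fun n => q ^ n) =O[atTop] (fun n => ((iterWord φ n [b]).length : ℝ))

/-- The letter `b` has order `> k`: a finite order greater than `k`, or
order `∞`. -/
def HasOrderGT {A : Type*} (φ : A → List A) (b : A) (k : ℕ) : Prop :=
  (∃ k' : ℕ, k < k' ∧ HasOrder φ b k') ∨ HasOrderInf φ b

/-- `c` is the leftmost letter of order `> k` occurring in the word `w`. -/
def IsLeftmostGT {A : Type*} (φ : A → List A) (k : ℕ) (w : List A) (c : A) : Prop :=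
  ∃ i : Fin w.length, w.get i = c ∧ HasOrderGT φ c k ∧
    ∀ j : Fin w.length, (j : ℕ) < (i : ℕ) → ¬ HasOrderGT φ (w.get j) k

/-- `c` is the rightmost letter of order `> k` occurring in the word `w`. -/
def IsRightmostGT {A : Type*} (φ : A → List A) (k : ℕ) (w : List A) (c : A) : Prop :=
  ∃ i : Fin w.length, w.get i = c ∧ HasOrderGT φ c k ∧
    ∀ j : Fin w.length, (i : ℕ) < (j : ℕ) → ¬ HasOrderGT φ (w.get j) k

/-! ### Words and iterated morphisms -/

section Words

variable {A : Type*} (φ : A → List A)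

theorem substWord_eq_flatMap (w : List A) : substWord φ w = w.flatMap φ := by
  induction w with
  | nil => rfl
  | cons a w ih => simp [substWord, ih]

theorem iterWord_zero (w : List A) : iterWord φ 0 w = w := rfl

theorem iterWord_succ (n : ℕ) (w : List A) :
    iterWord φ (n + 1) w = substWord φ (iterWord φ n w) :=
  Function.iterate_succ_apply' _ _ _

theorem iterWord_add (m n : ℕ) (w : List A) :
    iterWord φ (m + n) w = iterWord φ m (iterWord φ n w) :=
  Function.iterate_add_apply _ _ _ _

theorem iterWord_one_singleton (b : A) : iterWord φ 1 [b] = φ b := by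
  simp [iterWord, substWord]

theorem iterWord_append (n : ℕ) (u v : List A) :
    iterWord φ n (u ++ v) = iterWord φ n u ++ iterWord φ n v := by
  induction n with
  | zero => rfl
  | succ n ih => simp [iterWord_succ, ih, substWord_eq_flatMap]

theorem iterWord_nil (n : ℕ) : iterWord φ n [] = [] := by
  induction n with
  | zero => rfl
  | succ n ih => rw [iterWord_succ, ih, substWord]

theorem iterWord_cons (n : ℕ) (a : A) (w : List A) :
    iterWord φ n (a :: w) = iterWord φ n [a] ++ iterWord φ n w :=
  iterWord_append φ n [a] w

theorem List.Perm.iterWord {u v : List A} (h : u.Perm v) (n : ℕ) :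
    (iterWord φ n u).Perm (iterWord φ n v) := by
  induction n with
  | zero => exact h
  | succ n ih =>
    simp only [iterWord_succ, substWord_eq_flatMap]
    exact ih.flatMap_right φ

theorem mem_iterWord_of_mem {n : ℕ} {w : List A} {a c : A} (ha : a ∈ w)
    (hc : c ∈ iterWord φ n [a]) : c ∈ iterWord φ n w := by
  obtain ⟨u, v, rfl⟩ := List.append_of_mem ha
  rw [iterWord_append, iterWord_cons]
  simp [hc]

theorem mem_iterWord_add {m n : ℕ} {a b c : A} (hb : b ∈ iterWord φ n [a])
    (hc : c ∈ iterWord φ m [b]) : c ∈ iterWord φ (m + n) [a] := by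
  rw [iterWord_add]
  exact mem_iterWord_of_mem φ hb hc

theorem self_mem_iterWord_mul {p : ℕ} {b : A} (hb : b ∈ iterWord φ p [b]) (t : ℕ) :
    b ∈ iterWord φ (t * p) [b] := by
  induction t with
  | zero => simp [iterWord_zero]
  | succ t ih =>
    rw [Nat.succ_mul]
    exact mem_iterWord_add φ hb ih

/-- The length of `φ^n(b)`. -/
def iterLen (b : A) (n : ℕ) : ℕ := (iterWord φ n [b]).length

theorem length_iterWord (n : ℕ) (w : List A) :
    (iterWord φ n w).length = (w.map fun c => iterLen φ c n).sum := by
  induction w with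
  | nil => simp [iterWord_nil]
  | cons a w ih => rw [iterWord_cons, List.length_append, ih]; rfl

theorem iterLen_add (b : A) (n j : ℕ) :
    iterLen φ b (n + j) = ((iterWord φ j [b]).map fun c => iterLen φ c n).sum := by
  rw [iterLen, iterWord_add, length_iterWord]

theorem iterLen_le_of_mem {b c : A} {j : ℕ} (hc : c ∈ iterWord φ j [b]) (n : ℕ) :
    iterLen φ c n ≤ iterLen φ b (n + j) := by
  rw [iterLen_add]
  exact List.single_le_sum (by simp) _ (List.mem_map.2 ⟨c, hc, rfl⟩)

theorem length_le_length_substWord (hφ : ∀ b : A, φ b ≠ []) (w : List A) :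
    w.length ≤ (substWord φ w).length := by
  induction w with
  | nil => simp
  | cons a w ih =>
    have := List.length_pos_iff.2 (hφ a)
    simp only [substWord, List.length_append, List.length_cons]
    omega

theorem iterLen_mono (hφ : ∀ b : A, φ b ≠ []) (b : A) : Monotone (iterLen φ b) := by
  refine monotone_nat_of_le_succ fun n => ?_
  rw [iterLen, iterLen, iterWord_succ]
  exact length_le_length_substWord φ hφ _

theorem one_le_iterLen (hφ : ∀ b : A, φ b ≠ []) (b : A) (n : ℕ) : 1 ≤ iterLen φ b n :=
  iterLen_mono φ hφ b (Nat.zero_le n)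

end Words

/-! ### Polynomial growth of integer sequences -/

section Growth

/-- `f n` is at least a positive constant times `(n + 1) ^ d`. -/
def PolyLower (f : ℕ → ℕ) (d : ℕ) : Prop := ∃ C : ℕ, ∀ n, (n + 1) ^ d ≤ C * f n

/-- `f n` is at most a constant times `(n + 1) ^ d`. -/
def PolyUpper (f : ℕ → ℕ) (d : ℕ) : Prop := ∃ C : ℕ, ∀ n, f n ≤ C * (n + 1) ^ d

theorem PolyUpper.mono {f : ℕ → ℕ} {d e : ℕ} (h : PolyUpper f d) (hde : d ≤ e) :
    PolyUpper f e := by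
  obtain ⟨C, hC⟩ := h
  exact ⟨C, fun n => (hC n).trans (by gcongr; omega)⟩

theorem PolyUpper.add {f g : ℕ → ℕ} {d : ℕ} (hf : PolyUpper f d) (hg : PolyUpper g d) :
    PolyUpper (fun n => f n + g n) d := by
  obtain ⟨C, hC⟩ := hf
  obtain ⟨D, hD⟩ := hg
  refine ⟨C + D, fun n => ?_⟩
  rw [add_mul]
  exact add_le_add (hC n) (hD n)

theorem PolyLower.of_le {f g : ℕ → ℕ} {d : ℕ} (hf : PolyLower f d) (hfg : ∀ n, f n ≤ g n) :
    PolyLower g d := by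
  obtain ⟨C, hC⟩ := hf
  exact ⟨C, fun n => (hC n).trans (Nat.mul_le_mul_left _ (hfg n))⟩

theorem PolyLower.le_of_polyUpper {f : ℕ → ℕ} {d e : ℕ} (hl : PolyLower f d)
    (hu : PolyUpper f e) : d ≤ e := by
  obtain ⟨C, hC⟩ := hl
  obtain ⟨D, hD⟩ := hu
  by_contra! hlt
  have h := (hC (C * D)).trans (Nat.mul_le_mul_left C (hD (C * D)))
  have h' : (C * D + 1) ^ (e + 1) ≤ (C * D + 1) ^ d := Nat.pow_le_pow_right (by omega) hlt
  have hp : 0 < (C * D + 1) ^ e := by positivity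
  rw [pow_succ] at h'
  nlinarith

theorem succ_succ_pow_le (n d : ℕ) : (n + 2) ^ d ≤ 2 ^ d * (n + 1) ^ d := by
  rw [← mul_pow]
  exact Nat.pow_le_pow_left (by omega) d

theorem PolyLower.of_shift {f : ℕ → ℕ} {d : ℕ} (h0 : 1 ≤ f 0)
    (h : PolyLower (fun n => f (n + 1)) d) : PolyLower f d := by
  obtain ⟨C, hC⟩ := h
  refine ⟨2 ^ d * C + 1, fun n => ?_⟩
  cases n with
  | zero => simp only [zero_add, one_pow]; nlinarith [Nat.zero_le (2 ^ d * C * f 0)]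
  | succ n =>
    calc (n + 1 + 1) ^ d ≤ 2 ^ d * (n + 1) ^ d := succ_succ_pow_le n d
      _ ≤ 2 ^ d * (C * f (n + 1)) := Nat.mul_le_mul_left _ (hC n)
      _ ≤ (2 ^ d * C + 1) * f (n + 1) := by rw [← mul_assoc]; gcongr; omega

theorem PolyLower.shift {f : ℕ → ℕ} {d : ℕ} (h : PolyLower f d) :
    PolyLower (fun n => f (n + 1)) d := by
  obtain ⟨C, hC⟩ := h
  exact ⟨C, fun n => (Nat.pow_le_pow_left (by omega) d).trans (hC (n + 1))⟩

theorem PolyUpper.of_shift {f : ℕ → ℕ} {d : ℕ} (hf : Monotone f)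
    (h : PolyUpper (fun n => f (n + 1)) d) : PolyUpper f d := by
  obtain ⟨C, hC⟩ := h
  exact ⟨C, fun n => (hf (Nat.le_succ n)).trans (hC n)⟩

theorem polyUpper_list_sum {ι : Type*} (F : ι → ℕ → ℕ) (d : ℕ) (l : List ι)
    (h : ∀ i ∈ l, PolyUpper (F i) d) : PolyUpper (fun n => (l.map fun i => F i n).sum) d := by
  induction l with
  | nil => exact ⟨0, fun n => by simp⟩
  | cons i l ih =>
    simp only [List.map_cons, List.sum_cons]
    exact (h i (by simp)).add (ih fun j hj => h j (by simp [hj]))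

/-- `f n = Θ((n + 1) ^ d)`. -/
def PolyGrowth (f : ℕ → ℕ) (d : ℕ) : Prop := PolyLower f d ∧ PolyUpper f d

theorem exists_polyGrowth_list_sum {ι : Type*} (F : ι → ℕ → ℕ) (l : List ι) (hl : l ≠ [])
    (h : ∀ i ∈ l, ∃ d, PolyGrowth (F i) d) :
    ∃ d, PolyGrowth (fun n => (l.map fun i => F i n).sum) d := by
  classical
  choose! d hd using h
  obtain ⟨i, hi, hmax⟩ :=
    l.toFinset.exists_max_image d (by simpa [List.toFinset_nonempty_iff] using hl)
  rw [List.mem_toFinset] at hi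
  refine ⟨d i, (hd i hi).1.of_le fun n => ?_, polyUpper_list_sum F _ l fun j hj => ?_⟩
  · exact List.single_le_sum (by simp) _ (List.mem_map.2 ⟨i, hi, rfl⟩)
  · exact (hd j hj).2.mono (hmax j (by simpa using hj))

theorem add_pow_succ_le (x p d : ℕ) :
    (x + p) ^ (d + 1) ≤ x ^ (d + 1) + p * (d + 1) * (x + p) ^ d := by
  induction d with
  | zero => simp
  | succ d ih =>
    have hx : x * (x + p) ^ d ≤ (x + p) ^ (d + 1) := by
      rw [pow_succ, mul_comm]
      exact Nat.mul_le_mul_left _ (by omega)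
    calc (x + p) ^ (d + 1 + 1) = x * (x + p) ^ (d + 1) + p * (x + p) ^ (d + 1) := by ring
      _ ≤ x * (x ^ (d + 1) + p * (d + 1) * (x + p) ^ d) + p * (x + p) ^ (d + 1) := by gcongr
      _ = x ^ (d + 1 + 1) + p * (d + 1) * (x * (x + p) ^ d) + p * (x + p) ^ (d + 1) := by ring
      _ ≤ x ^ (d + 1 + 1) + p * (d + 1) * (x + p) ^ (d + 1) + p * (x + p) ^ (d + 1) := by
        gcongr
      _ = _ := by ring

/-- Induction on `ℕ` in steps of length `p`. -/
theorem Nat.step_induction {P : ℕ → Prop} {p : ℕ} (hp : 1 ≤ p) (base : ∀ n < p, P n)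
    (step : ∀ n, P n → P (n + p)) (n : ℕ) : P n := by
  induction n using Nat.strong_induction_on with
  | _ n ih =>
    by_cases hn : n < p
    · exact base n hn
    · have := step (n - p) (ih _ (by omega))
      rwa [Nat.sub_add_cancel (by omega)] at this

theorem PolyGrowth.of_step {f g : ℕ → ℕ} {p d : ℕ} (hp : 1 ≤ p) (hf : Monotone f)
    (h0 : 1 ≤ f 0) (hstep : ∀ n, f (n + p) = f n + g n) (hg : PolyGrowth g d) :
    PolyGrowth f (d + 1) := by
  obtain ⟨⟨C, hC⟩, ⟨D, hD⟩⟩ := hg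
  have hpos : ∀ n, 1 ≤ f n := fun n => h0.trans (hf (Nat.zero_le n))
  constructor
  · refine ⟨p * (d + 1) * ((p + 1) ^ d * C) + p ^ (d + 1), Nat.step_induction hp ?_ ?_⟩
    · intro n hn
      have h1 : (n + 1) ^ (d + 1) ≤ p ^ (d + 1) := Nat.pow_le_pow_left hn _
      have h2 := Nat.mul_le_mul (Nat.le_add_left (p ^ (d + 1))
        (p * (d + 1) * ((p + 1) ^ d * C))) (hpos n)
      omega
    · intro n ih
      rw [hstep, mul_add]
      have h1 := add_pow_succ_le (n + 1) p d
      have h2 : (n + 1 + p) ^ d ≤ (p + 1) ^ d * (n + 1) ^ d := by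
        rw [← mul_pow]
        exact Nat.pow_le_pow_left (by nlinarith [Nat.zero_le (p * n)]) d
      have h3 : p * (d + 1) * (n + 1 + p) ^ d ≤ p * (d + 1) * ((p + 1) ^ d * (C * g n)) := by
        gcongr
        exact h2.trans (Nat.mul_le_mul_left _ (hC n))
      rw [show n + p + 1 = n + 1 + p by ring]
      nlinarith [Nat.zero_le (p ^ (d + 1) * g n)]
  · refine ⟨D + f p, Nat.step_induction hp ?_ ?_⟩
    · intro n hn
      have h1 : f n ≤ f p := hf hn.le
      have h2 := Nat.mul_le_mul (Nat.le_add_left (f p) D)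
        (Nat.one_le_pow (d + 1) (n + 1) (by omega))
      omega
    · intro n ih
      have h1 : (n + 1) ^ d * (n + 2) ≤ (n + p + 1) ^ (d + 1) := by
        rw [pow_succ]
        exact Nat.mul_le_mul (Nat.pow_le_pow_left (by omega) d) (by omega)
      have h2 := Nat.mul_le_mul_left (D + f p) h1
      have h3 := hD n
      rw [hstep]
      rw [pow_succ] at ih
      nlinarith [Nat.zero_le (f p * (n + 1) ^ d)]

theorem PolyGrowth.of_periodic {f : ℕ → ℕ} {p : ℕ} (hp : 1 ≤ p) (hf : Monotone f)
    (h0 : 1 ≤ f 0) (hstep : ∀ n, f (n + p) = f n) : PolyGrowth f 0 := by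
  refine ⟨⟨1, fun n => ?_⟩, ⟨f p, Nat.step_induction hp (fun n hn => ?_) fun n ih => ?_⟩⟩
  · simpa using h0.trans (hf (Nat.zero_le n))
  · simpa using hf hn.le
  · simpa [hstep] using ih

end Growth

/-! ### The growth dichotomy -/

section Dichotomy

variable {A : Type*} {φ : A → List A}

theorem hasOrder_of_polyGrowth {b : A} {d : ℕ} (h : PolyGrowth (iterLen φ b) d) :
    HasOrder φ b (d + 1) := by
  obtain ⟨⟨C, hC⟩, ⟨D, hD⟩⟩ := h
  refine ⟨by omega, ?_, ?_⟩
  · refine IsBigO.of_bound (D * 2 ^ d : ℕ) ?_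
    filter_upwards [eventually_ge_atTop 1] with n hn
    have h1 : (n + 1) ^ d ≤ 2 ^ d * n ^ d := by
      rw [← mul_pow]
      exact Nat.pow_le_pow_left (by omega) d
    have h2 := (hD n).trans (Nat.mul_le_mul_left D h1)
    rw [← mul_assoc] at h2
    simpa [iterLen] using (by exact_mod_cast h2 :
      (iterLen φ b n : ℝ) ≤ ((D * 2 ^ d : ℕ) : ℝ) * (n : ℝ) ^ d)
  · refine IsBigO.of_bound (C : ℝ) (Eventually.of_forall fun n => ?_)
    have h2 := (Nat.pow_le_pow_left (Nat.le_succ n) d).trans (hC n)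
    simpa [iterLen] using (by exact_mod_cast h2 : (n : ℝ) ^ d ≤ (C : ℝ) * (iterLen φ b n : ℝ))

theorem polyLower_of_isBigO (hφ : ∀ b : A, φ b ≠ []) {b : A} {k : ℕ}
    (h : (fun n : ℕ => (n : ℝ) ^ k) =O[atTop] fun n => (iterLen φ b n : ℝ)) :
    PolyLower (iterLen φ b) k := by
  obtain ⟨C, -, hC⟩ := bound_of_isBigO_nat_atTop h
  obtain ⟨D, hD⟩ := exists_nat_ge C
  refine PolyLower.of_shift (one_le_iterLen φ hφ b 0) ⟨D, fun n => ?_⟩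
  have hne : (iterLen φ b (n + 1) : ℝ) ≠ 0 := by
    have := one_le_iterLen φ hφ b (n + 1)
    positivity
  have h1 := hC hne
  rw [norm_pow, Real.norm_natCast, Real.norm_natCast] at h1
  have h2 := h1.trans (mul_le_mul_of_nonneg_right hD (Nat.cast_nonneg _))
  exact_mod_cast h2

theorem polyLower_of_hasOrderGT (hφ : ∀ b : A, φ b ≠ []) {b : A} {k : ℕ}
    (h : HasOrderGT φ b k) : PolyLower (iterLen φ b) k := by
  refine polyLower_of_isBigO hφ ?_
  rcases h with ⟨k', hk, -, hΘ⟩ | ⟨q, hq, hO⟩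
  · refine IsBigO.trans (IsBigO.of_bound 1 ?_) hΘ.2
    filter_upwards [eventually_ge_atTop 1] with n hn
    rw [norm_pow, norm_pow, Real.norm_natCast, one_mul]
    exact pow_le_pow_right₀ (by exact_mod_cast hn) (by omega)
  · exact (isLittleO_pow_const_const_pow_of_one_lt k hq).isBigO.trans hO

theorem hasOrderInf_of_two_mul_le (hφ : ∀ b : A, φ b ≠ []) {b : A} {p : ℕ} (hp : 1 ≤ p)
    (h : ∀ n, 2 * iterLen φ b n ≤ iterLen φ b (n + p)) : HasOrderInf φ b := by
  have hpow : ((2 : ℝ) ^ ((p : ℝ)⁻¹)) ^ p = 2 := Real.rpow_inv_natCast_pow (by norm_num) (by omega)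
  have hq : 1 < (2 : ℝ) ^ ((p : ℝ)⁻¹) := Real.one_lt_rpow (by norm_num) (by positivity)
  generalize (2 : ℝ) ^ ((p : ℝ)⁻¹) = q at hpow hq
  refine ⟨q, hq, IsBigO.of_bound 2 (Eventually.of_forall ?_)⟩
  refine Nat.step_induction hp (fun n hn => ?_) fun n ih => ?_
  · have h1 : q ^ n ≤ q ^ p := pow_le_pow_right₀ hq.le hn.le
    have h2 : (1 : ℝ) ≤ ((iterWord φ n [b]).length : ℝ) := by
      exact_mod_cast one_le_iterLen φ hφ b n
    rw [Real.norm_natCast, Real.norm_of_nonneg (by positivity)]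
    linarith
  · have h1 : (2 : ℝ) * ((iterWord φ n [b]).length : ℝ) ≤
        ((iterWord φ (n + p) [b]).length : ℝ) := by exact_mod_cast h n
    rw [Real.norm_natCast, Real.norm_of_nonneg (by positivity)] at ih ⊢
    rw [pow_add, hpow]
    linarith

theorem HasOrderInf.of_mem_iterWord {b c : A} {j : ℕ} (hc : c ∈ iterWord φ j [b])
    (h : HasOrderInf φ c) : HasOrderInf φ b := by
  obtain ⟨q, hq, hO⟩ := h
  refine ⟨q, hq, ?_⟩
  obtain ⟨C, hC⟩ := hO.bound
  refine IsBigO.of_bound (C * q ^ j) ?_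
  rw [← map_add_atTop_eq_nat j, eventually_map]
  filter_upwards [hC] with n hn
  have h1 : ((iterWord φ n [c]).length : ℝ) ≤ ((iterWord φ (n + j) [b]).length : ℝ) := by
    exact_mod_cast iterLen_le_of_mem φ hc n
  have hqj : 0 < q ^ j := by positivity
  have hqn : 0 < q ^ n := by positivity
  rw [Real.norm_natCast, Real.norm_of_nonneg (by positivity)] at hn ⊢
  have hCpos : 0 ≤ C := by
    by_contra! hneg
    nlinarith [Nat.cast_nonneg (α := ℝ) (iterWord φ n [c]).length]
  calc q ^ (n + j) = q ^ n * q ^ j := pow_add _ _ _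
    _ ≤ C * ((iterWord φ (n + j) [b]).length : ℝ) * q ^ j := by
      gcongr
      exact hn.trans (mul_le_mul_of_nonneg_left h1 hCpos)
    _ = _ := by ring

/-- A letter occurring twice in one of its own iterated images has order `∞`. -/
theorem hasOrderInf_of_perm_cons_cons (hφ : ∀ b : A, φ b ≠ []) {b : A} {p : ℕ} (hp : 1 ≤ p)
    {r : List A} (h : (iterWord φ p [b]).Perm (b :: b :: r)) : HasOrderInf φ b := by
  refine hasOrderInf_of_two_mul_le hφ hp fun n => ?_
  rw [iterLen_add, (h.map _).sum_eq]
  simp only [List.map_cons, List.sum_cons]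
  omega

/-- If a second letter of `φ^p(b)`, besides an occurrence of `b`, leads back to `b`, then `b` has
order `∞`. -/
theorem hasOrderInf_of_return (hφ : ∀ b : A, φ b ≠ []) {b c : A} {p q : ℕ} (hp : 1 ≤ p)
    {r : List A} (h : (iterWord φ p [b]).Perm (b :: r)) (hc : c ∈ r)
    (hb : b ∈ iterWord φ q [c]) : HasOrderInf φ b := by
  obtain ⟨s, rfl⟩ : ∃ s, p = s + 1 := ⟨p - 1, by omega⟩
  have hloop : b ∈ iterWord φ (s + 1) [b] := h.mem_iff.2 (by simp)
  have hloop' : b ∈ iterWord φ (q + (s + 1)) [b] :=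
    mem_iterWord_add φ (h.mem_iff.2 (by simp [hc])) hb
  have h1 : b ∈ iterWord φ ((s + q) * (s + 1)) [b] := self_mem_iterWord_mul φ hloop _
  have h2 : b ∈ iterWord φ ((s + q) * (s + 1)) r := by
    refine mem_iterWord_of_mem φ hc ?_
    rw [show (s + q) * (s + 1) = s * (q + (s + 1)) + q by ring]
    exact mem_iterWord_add φ hb (self_mem_iterWord_mul φ hloop' s)
  obtain ⟨u₁, v₁, e₁⟩ := List.append_of_mem h1
  obtain ⟨u₂, v₂, e₂⟩ := List.append_of_mem h2
  refine hasOrderInf_of_perm_cons_cons hφ (p := (s + q) * (s + 1) + (s + 1))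
    (r := (u₁ ++ v₁) ++ (u₂ ++ v₂)) (by omega) ?_
  rw [iterWord_add]
  refine (h.iterWord φ _).trans ?_
  rw [iterWord_cons, e₁, e₂]
  refine (List.perm_middle.append List.perm_middle).trans ?_
  exact List.Perm.cons b List.perm_middle

/-- Every letter grows polynomially or has order `∞`. -/
theorem exists_polyGrowth_or_hasOrderInf [Finite A] (hφ : ∀ b : A, φ b ≠ []) (b : A) :
    (∃ d, PolyGrowth (iterLen φ b) d) ∨ HasOrderInf φ b := by
  classical
  induction hN : {c | ∃ j, c ∈ iterWord φ j [b]}.ncard using Nat.strong_induction_on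
    generalizing b with
  | _ N ih =>
  subst hN
  by_cases hinf : HasOrderInf φ b
  · exact Or.inr hinf
  left
  have key : ∀ c j, c ∈ iterWord φ j [b] → (∀ q, b ∉ iterWord φ q [c]) →
      ∃ d, PolyGrowth (iterLen φ c) d := by
    intro c j hc hcb
    refine (ih _ (Set.ncard_lt_ncard ⟨?_, ?_⟩ (Set.toFinite _)) c rfl).resolve_right
      fun h => hinf (h.of_mem_iterWord hc)
    · rintro a ⟨i, ha⟩
      exact ⟨i + j, mem_iterWord_add φ hc ha⟩
    · intro hsub
      obtain ⟨q, hq⟩ := hsub (a := b) ⟨0, by simp [iterWord_zero]⟩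
      exact hcb q hq
  have hmono := iterLen_mono φ hφ b
  by_cases hcyc : ∃ p, 1 ≤ p ∧ b ∈ iterWord φ p [b]
  · obtain ⟨p, hp, hb⟩ := hcyc
    have hperm := List.perm_cons_erase hb
    have hstep : ∀ n, iterLen φ b (n + p) = iterLen φ b n +
        (((iterWord φ p [b]).erase b).map fun c => iterLen φ c n).sum := fun n => by
      rw [iterLen_add, (hperm.map _).sum_eq, List.map_cons, List.sum_cons]
    by_cases hr : (iterWord φ p [b]).erase b = []
    · exact ⟨0, PolyGrowth.of_periodic hp hmono le_rfl fun n => by simpa [hr] using hstep n⟩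
    · obtain ⟨d, hd⟩ := exists_polyGrowth_list_sum (iterLen φ) _ hr fun c hc =>
        key c p (List.mem_of_mem_erase hc) fun q hq =>
          hinf (hasOrderInf_of_return hφ hp hperm hc hq)
      exact ⟨d + 1, hd.of_step hp hmono le_rfl hstep⟩
  · push Not at hcyc
    obtain ⟨d, hl, hu⟩ := exists_polyGrowth_list_sum (iterLen φ) (iterWord φ 1 [b])
      (by simpa [iterWord_one_singleton] using hφ b) fun c hc =>
        key c 1 hc fun q hq => hcyc (q + 1) (by omega) (mem_iterWord_add φ hc hq)
    simp only [← iterLen_add] at hl hu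
    exact ⟨d, hl.of_shift le_rfl, hu.of_shift hmono⟩

theorem hasOrderGT_iff_polyLower [Finite A] (hφ : ∀ b : A, φ b ≠ []) {b : A} {k : ℕ} :
    HasOrderGT φ b k ↔ PolyLower (iterLen φ b) k := by
  refine ⟨polyLower_of_hasOrderGT hφ, fun h => ?_⟩
  rcases exists_polyGrowth_or_hasOrderInf hφ b with ⟨d, hd⟩ | hinf
  · exact Or.inl ⟨d + 1, by have := h.le_of_polyUpper hd.2; omega, hasOrder_of_polyGrowth hd⟩
  · exact Or.inr hinf

theorem HasOrderGT.of_mem [Finite A] (hφ : ∀ b : A, φ b ≠ []) {b c : A} {k : ℕ}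
    (hc : c ∈ φ b) (h : HasOrderGT φ c k) : HasOrderGT φ b k := by
  rw [← iterWord_one_singleton φ b] at hc
  rw [hasOrderGT_iff_polyLower hφ] at h ⊢
  exact (h.of_le (iterLen_le_of_mem φ hc)).of_shift le_rfl

theorem HasOrderGT.exists_mem [Finite A] (hφ : ∀ b : A, φ b ≠ []) {b : A} {k : ℕ}
    (hk : 1 ≤ k) (h : HasOrderGT φ b k) : ∃ c ∈ φ b, HasOrderGT φ c k := by
  by_contra! hno
  have hupper : ∀ c ∈ iterWord φ 1 [b], PolyUpper (iterLen φ c) (k - 1) := by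
    intro c hc
    rw [iterWord_one_singleton] at hc
    rcases exists_polyGrowth_or_hasOrderInf hφ c with ⟨d, hd⟩ | hinf
    · refine hd.2.mono ?_
      by_contra! hlt
      exact hno c hc (Or.inl ⟨d + 1, by omega, hasOrder_of_polyGrowth hd⟩)
    · exact absurd (Or.inr hinf) (hno c hc)
  have hu := polyUpper_list_sum _ _ _ hupper
  simp only [← iterLen_add] at hu
  have := ((hasOrderGT_iff_polyLower hφ).1 h).shift.le_of_polyUpper hu
  omega

end Dichotomy

/-! ### Extremal letters of high order -/

section Extremal

variable {A : Type*} {φ : A → List A} {k : ℕ}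

theorem isLeftmostGT_append_cons {u v : List A} {c : A} (hc : HasOrderGT φ c k)
    (hu : ∀ x ∈ u, ¬ HasOrderGT φ x k) : IsLeftmostGT φ k (u ++ c :: v) c := by
  refine ⟨⟨u.length, by simp⟩, by simp, hc, fun j hj => ?_⟩
  have hj' : (j : ℕ) < u.length := hj
  rw [List.get_eq_getElem, List.getElem_append_left hj']
  exact hu _ (List.getElem_mem hj')

theorem isRightmostGT_append_cons {u v : List A} {c : A} (hc : HasOrderGT φ c k)
    (hv : ∀ x ∈ v, ¬ HasOrderGT φ x k) : IsRightmostGT φ k (u ++ c :: v) c := by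
  refine ⟨⟨u.length, by simp⟩, by simp, hc, fun j hj => ?_⟩
  obtain ⟨j, hlt⟩ := j
  obtain ⟨i, rfl⟩ : ∃ i, j = u.length + (i + 1) := ⟨j - u.length - 1, by
    have : u.length < j := hj
    omega⟩
  simp only [List.get_eq_getElem, List.getElem_append_right (Nat.le_add_right _ _),
    Nat.add_sub_cancel_left, List.getElem_cons_succ]
  exact hv _ (List.getElem_mem _)

theorem not_hasOrderGT_of_mem_substWord [Finite A] (hφ : ∀ b : A, φ b ≠ []) {u : List A}
    (hu : ∀ x ∈ u, ¬ HasOrderGT φ x k) : ∀ x ∈ substWord φ u, ¬ HasOrderGT φ x k := by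
  intro x hx h
  rw [substWord_eq_flatMap, List.mem_flatMap] at hx
  obtain ⟨a, ha, hxa⟩ := hx
  exact hu a ha (h.of_mem hφ hxa)

theorem exists_leftmost_split {P : A → Prop} {w : List A} (h : ∃ c ∈ w, P c) :
    ∃ c u v, w = u ++ c :: v ∧ P c ∧ ∀ x ∈ u, ¬ P x := by
  induction w with
  | nil => simp at h
  | cons a w ih =>
    by_cases ha : P a
    · exact ⟨a, [], w, rfl, ha, by simp⟩
    · obtain ⟨c, u, v, rfl, hc, hu⟩ := ih (by simpa [ha] using h)
      exact ⟨c, a :: u, v, rfl, hc, by simpa [ha] using hu⟩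

theorem exists_rightmost_split {P : A → Prop} {w : List A} (h : ∃ c ∈ w, P c) :
    ∃ c u v, w = u ++ c :: v ∧ P c ∧ ∀ x ∈ v, ¬ P x := by
  obtain ⟨c, u, v, hw, hc, hu⟩ := exists_leftmost_split (w := w.reverse) (by simpa using h)
  exact ⟨c, v.reverse, u.reverse, by simpa using congrArg List.reverse hw, hc, by simpa using hu⟩

/-- The leftmost letters of order `> k` in the words `φ^n(b)` are the iterates of a single map. -/
theorem exists_iterate_isLeftmostGT [Finite A] (hφ : ∀ b : A, φ b ≠ []) (hk : 1 ≤ k) :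
    ∃ L : A → A, ∀ b, HasOrderGT φ b k →
      ∀ n, IsLeftmostGT φ k (iterWord φ n [b]) (L^[n] b) := by
  have hex : ∀ b, HasOrderGT φ b k → ∃ c u v, φ b = u ++ c :: v ∧ HasOrderGT φ c k ∧
      ∀ x ∈ u, ¬ HasOrderGT φ x k := fun b hb => exists_leftmost_split (hb.exists_mem hφ hk)
  choose! L U V hL using hex
  refine ⟨L, fun b hb n => ?_⟩
  obtain ⟨u, v, hw, hc, hu⟩ : ∃ u v, iterWord φ n [b] = u ++ L^[n] b :: v ∧
      HasOrderGT φ (L^[n] b) k ∧ ∀ x ∈ u, ¬ HasOrderGT φ x k := by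
    induction n with
    | zero => exact ⟨[], [], rfl, hb, by simp⟩
    | succ n ih =>
      obtain ⟨u, v, hw, hc, hu⟩ := ih
      obtain ⟨hsplit, hc', hu'⟩ := hL _ hc
      refine ⟨substWord φ u ++ U (L^[n] b), V (L^[n] b) ++ substWord φ v, ?_, ?_, ?_⟩
      · rw [iterWord_succ, hw, Function.iterate_succ_apply']
        simp only [substWord_eq_flatMap, List.flatMap_append, List.flatMap_cons]
        rw [hsplit]
        simp
      · rwa [Function.iterate_succ_apply']
      · intro x hx
        exact (List.mem_append.1 hx).elim (not_hasOrderGT_of_mem_substWord hφ hu x) (hu' x)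
  rw [hw]
  exact isLeftmostGT_append_cons hc hu

/-- The rightmost letters of order `> k` in the words `φ^n(b)` are the iterates of a single map. -/
theorem exists_iterate_isRightmostGT [Finite A] (hφ : ∀ b : A, φ b ≠ []) (hk : 1 ≤ k) :
    ∃ R : A → A, ∀ b, HasOrderGT φ b k →
      ∀ n, IsRightmostGT φ k (iterWord φ n [b]) (R^[n] b) := by
  have hex : ∀ b, HasOrderGT φ b k → ∃ c u v, φ b = u ++ c :: v ∧ HasOrderGT φ c k ∧
      ∀ x ∈ v, ¬ HasOrderGT φ x k := fun b hb => exists_rightmost_split (hb.exists_mem hφ hk)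
  choose! R U V hR using hex
  refine ⟨R, fun b hb n => ?_⟩
  obtain ⟨u, v, hw, hc, hv⟩ : ∃ u v, iterWord φ n [b] = u ++ R^[n] b :: v ∧
      HasOrderGT φ (R^[n] b) k ∧ ∀ x ∈ v, ¬ HasOrderGT φ x k := by
    induction n with
    | zero => exact ⟨[], [], rfl, hb, by simp⟩
    | succ n ih =>
      obtain ⟨u, v, hw, hc, hv⟩ := ih
      obtain ⟨hsplit, hc', hv'⟩ := hR _ hc
      refine ⟨substWord φ u ++ U (R^[n] b), V (R^[n] b) ++ substWord φ v, ?_, ?_, ?_⟩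
      · rw [iterWord_succ, hw, Function.iterate_succ_apply']
        simp only [substWord_eq_flatMap, List.flatMap_append, List.flatMap_cons]
        rw [hsplit]
        simp
      · rwa [Function.iterate_succ_apply']
      · intro x hx
        exact (List.mem_append.1 hx).elim (hv' x) (not_hasOrderGT_of_mem_substWord hφ hv x)
  rw [hw]
  exact isRightmostGT_append_cons hc hv

end Extremal

/-- Some iterate of a self-map of a finite type is stable under passing to multiples, and so are
all the multiples of that iterate. -/
theorem exists_iterate_mul_eq {A : Type*} [Finite A] (f : A → A) :
    ∃ n, 1 ≤ n ∧ ∀ t m, 1 ≤ t → 1 ≤ m → f^[n * t * m] = f^[n * t] := by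
  obtain ⟨i, j, hne, hij⟩ := Finite.exists_ne_map_eq_of_infinite fun n : ℕ => f^[n]
  wlog hlt : i < j generalizing i j
  · exact this j i hne.symm hij.symm (by omega)
  obtain ⟨p, rfl⟩ : ∃ p, j = i + p := ⟨j - i, by omega⟩
  have hper : ∀ s t, i ≤ s → f^[s + t * p] = f^[s] := by
    intro s t hs
    induction t with
    | zero => simp
    | succ t ih =>
      obtain ⟨r, hr⟩ : ∃ r, s + t * p = r + i := ⟨s + t * p - i, by omega⟩
      rw [Nat.succ_mul, ← add_assoc, ← ih, hr, add_assoc, Function.iterate_add,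
        Function.iterate_add _ r i, ← hij]
  have hp : 1 ≤ p := by omega
  refine ⟨(i + 1) * p, by nlinarith, fun t m ht hm => ?_⟩
  obtain ⟨m, rfl⟩ : ∃ m', m = m' + 1 := ⟨m - 1, by omega⟩
  rw [show (i + 1) * p * t * (m + 1) = (i + 1) * p * t + (i + 1) * t * m * p by ring]
  refine hper _ _ ?_
  have h1 : 1 ≤ p * t := Nat.mul_pos hp ht
  nlinarith

theorem exists_forall_iterate_mul_eq (A : Type*) [Finite A] :
    ∃ n, 1 ≤ n ∧ ∀ (f : A → A) (m : ℕ), 1 ≤ m → f^[n * m] = f^[n] := by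
  classical
  have := Fintype.ofFinite (A → A)
  choose N hN hstab using fun f : A → A => exists_iterate_mul_eq f
  refine ⟨∏ f, N f, Nat.one_le_iff_ne_zero.2 (Finset.prod_ne_zero_iff.2 fun f _ => ?_), ?_⟩
  · have := hN f
    omega
  · intro f m hm
    rw [← Finset.mul_prod_erase _ _ (Finset.mem_univ f)]
    refine hstab f _ m (Nat.one_le_iff_ne_zero.2 (Finset.prod_ne_zero_iff.2 fun g _ => ?_)) hm
    have := hN g
    omega

/-- There exists `n ≥ 1` such that for every `k ≥ 1` and every letter `b` of
order `> k`, the leftmost (resp. rightmost) letter of order `> k` in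
`φ^(nm)(b)` is the same letter for all `m ≥ 1`. -/
theorem stmt10 {A : Type*} [Fintype A] (φ : A → List A)
    (hφ : ∀ b : A, φ b ≠ []) :
    ∃ n : ℕ, 1 ≤ n ∧ ∀ k : ℕ, 1 ≤ k → ∀ b : A, HasOrderGT φ b k →
      (∃ cL : A, ∀ m : ℕ, 1 ≤ m → IsLeftmostGT φ k (iterWord φ (n * m) [b]) cL) ∧
      (∃ cR : A, ∀ m : ℕ, 1 ≤ m → IsRightmostGT φ k (iterWord φ (n * m) [b]) cR) := by
  obtain ⟨n, hn, hstab⟩ := exists_forall_iterate_mul_eq A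
  refine ⟨n, hn, fun k hk b hb => ?_⟩
  obtain ⟨L, hL⟩ := exists_iterate_isLeftmostGT hφ hk
  obtain ⟨R, hR⟩ := exists_iterate_isRightmostGT hφ hk
  refine ⟨⟨L^[n] b, fun m hm => ?_⟩, ⟨R^[n] b, fun m hm => ?_⟩⟩
  · rw [← hstab L m hm]
    exact hL b hb _
  · rw [← hstab R m hm]
    exact hR b hb _
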